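/- Lower bound half of the variational principle: for every f ∈ C(X_1), sup_{μ∈M^G(X_1)} ( Σ_{i=1}^r w_i h_{μ_i}(X_i,G) + w_1 ∫_{X_1} f dμ ) ≤ P^a(f,G). -/

import Mathlib

open scoped BigOperators NNReal
open Filter

namespace WPP

variable (G : Type) [Group G]

/-- `B(F,K) = {g ∈ G : Kg ∩ F ≠ ∅ and Kg ∩ (G∖F) ≠ ∅}`. -/
def folnerB (F K : Finset G) : Set G :=
  {g : G | (∃ k ∈ K, k * g ∈ F) ∧ ∃ k ∈ K, k * g ∉ F}

/-- A Følner sequence of `G`. -/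
def IsFolner (F : ℕ → Finset G) : Prop :=
  (∀ n, (F n).Nonempty) ∧
    ∀ K : Finset G, K.Nonempty →
      Tendsto (fun n => ((folnerB G (F n) K).ncard : ℝ) / ((F n).card : ℝ)) atTop (nhds 0)

/-- A `G`-system: a compact metric space together with a continuous action of `G`
by homeomorphisms. -/
structure GSystem where
  carrier : Type
  [metric : MetricSpace carrier]
  [cpt : CompactSpace carrier]
  act : G → carrier → carrier
  one_act : ∀ x, act 1 x = x
  mul_act : ∀ g h x, act (g * h) x = act g (act h x)
  cont_act : ∀ g, Continuous (act g)

attribute [instance] GSystem.metric GSystem.cpt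

variable {G}

noncomputable instance (S : GSystem G) : MeasurableSpace S.carrier := borel S.carrier
instance (S : GSystem G) : BorelSpace S.carrier := ⟨rfl⟩

/-- A factor map between `G`-systems: a continuous equivariant surjection. -/
structure FactorMap (S T : GSystem G) where
  toFun : S.carrier → T.carrier
  cont : Continuous toFun
  surj : Function.Surjective toFun
  equiv : ∀ g x, toFun (S.act g x) = T.act g (toFun x)

/-- The dynamical (Bowen) metric `d_F(x,y) = max_{g∈F} d(gx,gy)`. -/
noncomputable def dynDist (S : GSystem G) (F : Finset G) (x y : S.carrier) : ℝ :=
  ((F.sup fun g => nndist (S.act g x) (S.act g y) : ℝ≥0) : ℝ)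

/-- `diam(U, d_F) < ε`. -/
def diamLT (S : GSystem G) (F : Finset G) (U : Set S.carrier) (ε : ℝ) : Prop :=
  ∀ x ∈ U, ∀ y ∈ U, dynDist S F x y < ε

/-- The Birkhoff-type sum `S_F f(x) = Σ_{g∈F} f(gx)`. -/
noncomputable def birk (S : GSystem G) (f : S.carrier → ℝ) (F : Finset G) (x : S.carrier) : ℝ :=
  ∑ g ∈ F, f (S.act g x)

variable (X : ℕ → GSystem G) (π : ∀ i, FactorMap (X i) (X (i + 1)))

/-- The recursively defined weighted quantities `P^a_{i+1}(Ω, f, F, ε)` (0-indexed: `wP … i`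
corresponds to the paper's `P^a_{i+1}`, and `a i` to the paper's `a_{i+1}`). -/
noncomputable def wP (a : ℕ → ℝ) (f : (X 0).carrier → ℝ) (F : Finset G) (ε : ℝ) :
    (i : ℕ) → Set (X i).carrier → ℝ
  | 0, Ω => sInf {s | ∃ (n : ℕ) (U : Fin n → Set (X 0).carrier),
      (∀ j, IsOpen (U j)) ∧ (Ω ⊆ ⋃ j, U j) ∧ (∀ j, diamLT (X 0) F (U j) ε) ∧
      s = ∑ j, Real.exp (sSup (birk (X 0) f F '' U j))}
  | i + 1, Ω => sInf {s | ∃ (n : ℕ) (U : Fin n → Set (X (i + 1)).carrier),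
      (∀ j, IsOpen (U j)) ∧ (Ω ⊆ ⋃ j, U j) ∧ (∀ j, diamLT (X (i + 1)) F (U j) ε) ∧
      s = ∑ j, (wP a f F ε i ((π i).toFun ⁻¹' U j)) ^ (a i)}

/-- `lim_n log P^a_r(X_r, f, F_n, ε) / |F_n|` (realized as a `limsup` in `EReal`; by the
Ornstein–Weiss lemma the limit exists, so this is the limit). -/
noncomputable def pressEps (r : ℕ) (a : ℕ → ℝ) (f : (X 0).carrier → ℝ)
    (Fn : ℕ → Finset G) (ε : ℝ) : EReal :=
  limsup (fun n =>
    ((Real.log (wP X π a f (Fn n) ε (r - 1) Set.univ) / ((Fn n).card : ℝ) : ℝ) : EReal)) atTop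

/-- The `a`-weighted topological pressure `P^a(f,G) = lim_{ε→0} P^a(X_r,f,ε)`; since
`P^a(X_r,f,ε)` is non-decreasing as `ε` decreases, the limit equals the supremum over `ε > 0`. -/
noncomputable def press (r : ℕ) (a : ℕ → ℝ) (f : (X 0).carrier → ℝ)
    (Fn : ℕ → Finset G) : EReal :=
  ⨆ (ε : ℝ) (_ : 0 < ε), pressEps X π r a f Fn ε

/-- Entropy `H_μ(p)` of a countable partition given by the fibers of `p`. -/
noncomputable def Hpart {Y : Type} [MeasurableSpace Y] {ι : Type}
    (μ : MeasureTheory.Measure Y) (p : Y → ι) : ℝ :=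
  ∑' i : ι, Real.negMulLog ((μ (p ⁻¹' {i})).toReal)

/-- `h_μ(p, G) = lim_n H_μ(p_{F_n})/|F_n|` (realized as a `limsup`, which equals the limit
since the limit exists). -/
noncomputable def hSeq (S : GSystem G) (Fn : ℕ → Finset G)
    (μ : MeasureTheory.Measure S.carrier) (p : S.carrier → ℕ) : ℝ :=
  limsup (fun n =>
    Hpart μ (fun x => fun g : (Fn n : Finset G) => p (S.act (g : G) x)) / ((Fn n).card : ℝ)) atTop

/-- The measure-theoretic entropy `h_μ(X,G)`: supremum of `h_μ(α,G)` over all finite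
measurable partitions (encoded as measurable maps to `ℕ` with finite range). -/
noncomputable def mEnt (S : GSystem G) (Fn : ℕ → Finset G)
    (μ : MeasureTheory.Measure S.carrier) : EReal :=
  ⨆ p : {p : S.carrier → ℕ // Measurable p ∧ (Set.range p).Finite},
    ((hSeq S Fn μ p.1 : ℝ) : EReal)

/-- `μ ∈ M^G(X)`: a `G`-invariant Borel probability measure. -/
def IsInvProb (S : GSystem G) (μ : MeasureTheory.Measure S.carrier) : Prop :=
  MeasureTheory.IsProbabilityMeasure μ ∧ ∀ g : G, μ.map (S.act g) = μ

/-- `π^{(i)} = π_i ∘ ⋯ ∘ π_1 : X_1 → X_{i+1}` (0-indexed). -/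
noncomputable def chainMap : (i : ℕ) → (X 0).carrier → (X i).carrier
  | 0 => id
  | i + 1 => (π i).toFun ∘ chainMap i

/-- The weights `w_1 = a_1⋯a_{r−1}`, `w_i = (1−a_{i−1})a_i⋯a_{r−1}`, `w_r = 1−a_{r−1}`
(0-indexed: `wt a r i` is the paper's `w_{i+1}`, `a j` the paper's `a_{j+1}`). -/
noncomputable def wt (a : ℕ → ℝ) (r i : ℕ) : ℝ :=
  if i = 0 then ∏ j ∈ Finset.range (r - 1), a j
  else (1 - a (i - 1)) * ∏ j ∈ Finset.Ico i (r - 1), a j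

/-- `Σ_{i=1}^r w_i h_{μ_i}(X_i,G) + w_1 ∫ f dμ`. -/
noncomputable def wSum (r : ℕ) (a : ℕ → ℝ) (Fn : ℕ → Finset G) (f : (X 0).carrier → ℝ)
    (μ : MeasureTheory.Measure (X 0).carrier) : EReal :=
  (∑ i ∈ Finset.range r, ((wt a r i : ℝ) : EReal) * mEnt (X i) Fn (μ.map (chainMap X π i)))
    + (((wt a r 0) * ∫ x, f x ∂μ : ℝ) : EReal)

/-- `P^a_var(f,G) = sup_{μ ∈ M^G(X_1)} ( Σ w_i h_{μ_i}(X_i,G) + w_1 ∫ f dμ )`. -/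
noncomputable def Pvar (r : ℕ) (a : ℕ → ℝ) (Fn : ℕ → Finset G)
    (f : (X 0).carrier → ℝ) : EReal :=
  ⨆ μ : {μ : MeasureTheory.Measure (X 0).carrier // IsInvProb (X 0) μ},
    wSum X π r a Fn f μ.1

end WPP

namespace WPP

open MeasureTheory
open Real (exp log log_div log_mul log_pow negMulLog exp_pos log_exp rpow_nonneg rpow_one
  rpow_pos_of_pos log_rpow mul_rpow rpow_le_rpow_of_exponent_le le_log_iff_exp_le
  log_natCast_nonneg negMulLog_nonneg log_le_log log_le_sub_one_of_pos exp_sum)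

section FiniteEntropy

theorem negMulLog_add_le {x y : ℝ} (hx : 0 ≤ x) (hy : 0 ≤ y) :
    negMulLog (x + y) ≤ negMulLog x + negMulLog y := by
  have key : ∀ {u v : ℝ}, 0 ≤ u → 0 ≤ v → u * log u ≤ u * log (u + v) := by
    intro u v hu hv
    rcases hu.eq_or_lt with rfl | hu
    · simp
    · exact mul_le_mul_of_nonneg_left (log_le_log hu (by linarith)) hu.le
  have h1 := key hx hy
  have h2 := key hy hx
  rw [add_comm y x] at h2
  simp only [negMulLog]
  nlinarith

theorem negMulLog_sum_le {ι : Type*} (s : Finset ι) {m : ι → ℝ} (hm : ∀ i ∈ s, 0 ≤ m i) :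
    negMulLog (∑ i ∈ s, m i) ≤ ∑ i ∈ s, negMulLog (m i) := by
  classical
  induction s using Finset.induction_on with
  | empty => simp
  | insert j s hj ih =>
    rw [Finset.sum_insert hj, Finset.sum_insert hj]
    have h := ih fun i hi => hm i (Finset.mem_insert_of_mem hi)
    have h' := negMulLog_add_le (hm j (Finset.mem_insert_self j s))
      (Finset.sum_nonneg fun i hi => hm i (Finset.mem_insert_of_mem hi))
    linarith

/-- Gibbs' inequality for finitely many masses `m i` and weights `w i`. -/
theorem gibbs_inequality {ι : Type*} (s : Finset ι) {m w : ι → ℝ} (hm : ∀ i ∈ s, 0 ≤ m i)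
    (hw : ∀ i ∈ s, 0 ≤ w i) (hmw : ∀ i ∈ s, 0 < m i → 0 < w i) :
    ∑ i ∈ s, (negMulLog (m i) + m i * log (w i)) ≤
      negMulLog (∑ i ∈ s, m i) + (∑ i ∈ s, m i) * log (∑ i ∈ s, w i) := by
  rcases (Finset.sum_nonneg hm).eq_or_lt with h0 | hpos
  · have hz := (Finset.sum_eq_zero_iff_of_nonneg hm).1 h0.symm
    rw [← h0, Finset.sum_eq_zero fun i hi => by simp [hz i hi]]
    simp
  · set m₀ := ∑ i ∈ s, m i with hm₀
    set W := ∑ i ∈ s, w i with hW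
    obtain ⟨i₀, hi₀, hmi₀⟩ : ∃ i ∈ s, 0 < m i := by
      by_contra! h
      exact absurd (Finset.sum_nonpos h) (not_le.2 hpos)
    have hWpos : 0 < W :=
      lt_of_lt_of_le (hmw i₀ hi₀ hmi₀) (Finset.single_le_sum hw hi₀)
    have hterm : ∀ i ∈ s, negMulLog (m i) + m i * log (w i) ≤
        m i * (log W - log m₀) + (m₀ / W * w i - m i) := by
      intro i hi
      rcases (hm i hi).eq_or_lt with h | h
      · rw [← h]
        have := mul_nonneg (div_pos hpos hWpos).le (hw i hi)
        simpa using this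
      · have hwi := hmw i hi h
        have hlog := log_le_sub_one_of_pos (x := w i * m₀ / (W * m i)) (by positivity)
        rw [log_div (by positivity) (by positivity), log_mul hwi.ne' hpos.ne',
          log_mul hWpos.ne' h.ne'] at hlog
        have h2 := mul_le_mul_of_nonneg_left hlog h.le
        have h3 : m i * (w i * m₀ / (W * m i) - 1) = m₀ / W * w i - m i := by
          field_simp
        simp only [negMulLog]
        nlinarith
    refine (Finset.sum_le_sum hterm).trans (le_of_eq ?_)
    rw [Finset.sum_add_distrib, ← Finset.sum_mul, Finset.sum_sub_distrib, ← Finset.mul_sum,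
      ← hm₀, ← hW, div_mul_cancel₀ _ hWpos.ne']
    simp only [negMulLog]
    ring

theorem negMulLog_submodular {ι κ : Type*} [Fintype ι] [Fintype κ] {m : ι → κ → ℝ}
    (hm : ∀ i j, 0 ≤ m i j) :
    ∑ i, ∑ j, negMulLog (m i j) + negMulLog (∑ i, ∑ j, m i j) ≤
      ∑ i, negMulLog (∑ j, m i j) + ∑ j, negMulLog (∑ i, m i j) := by
  classical
  set r : ι → ℝ := fun i => ∑ j, m i j with hr
  set c : κ → ℝ := fun j => ∑ i, m i j with hc
  have hr0 : ∀ i, 0 ≤ r i := fun i => Finset.sum_nonneg fun j _ => hm i j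
  have hc0 : ∀ j, 0 ≤ c j := fun j => Finset.sum_nonneg fun i _ => hm i j
  have hmr : ∀ i j, m i j ≤ r i := fun i j =>
    Finset.single_le_sum (fun j _ => hm i j) (Finset.mem_univ j)
  have hmc : ∀ i j, m i j ≤ c j := fun i j =>
    Finset.single_le_sum (f := fun i => m i j) (fun i _ => hm i j) (Finset.mem_univ i)
  have hG := gibbs_inequality (Finset.univ : Finset (ι × κ)) (m := fun p => m p.1 p.2)
    (w := fun p => r p.1 * c p.2) (fun p _ => hm _ _)
    (fun p _ => mul_nonneg (hr0 _) (hc0 _))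
    (fun p _ h => mul_pos (h.trans_le (hmr _ _)) (h.trans_le (hmc _ _)))
  simp only [Fintype.sum_prod_type] at hG
  have hlog : ∀ i j, m i j * log (r i * c j) = m i j * log (r i) + m i j * log (c j) := by
    intro i j
    rcases (hm i j).eq_or_lt with h | h
    · simp [← h]
    · rw [log_mul (h.trans_le (hmr i j)).ne' (h.trans_le (hmc i j)).ne']
      ring
  have h1 : ∑ i, ∑ j, m i j * log (r i) = -∑ i, negMulLog (r i) := by
    rw [← Finset.sum_neg_distrib]
    refine Finset.sum_congr rfl fun i _ => ?_
    rw [← Finset.sum_mul]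
    simp only [negMulLog, hr]
    ring
  have h2 : ∑ i, ∑ j, m i j * log (c j) = -∑ j, negMulLog (c j) := by
    rw [Finset.sum_comm, ← Finset.sum_neg_distrib]
    refine Finset.sum_congr rfl fun j _ => ?_
    rw [← Finset.sum_mul]
    simp only [negMulLog, hc]
    ring
  have h3 : ∑ i, ∑ j, r i * c j = (∑ i, ∑ j, m i j) * ∑ i, ∑ j, m i j := by
    rw [← Finset.sum_mul_sum]
    congr 1
    exact Finset.sum_comm
  rw [h3] at hG
  simp only [hlog, Finset.sum_add_distrib] at hG
  rw [h1, h2] at hG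
  have h4 : (∑ i, ∑ j, m i j) * log ((∑ i, ∑ j, m i j) * ∑ i, ∑ j, m i j) =
      -(2 * negMulLog (∑ i, ∑ j, m i j)) := by
    rcases eq_or_ne (∑ i, ∑ j, m i j) 0 with h | h
    · simp [h]
    · rw [log_mul h h]
      simp only [negMulLog]
      ring
  rw [h4] at hG
  linarith

variable {Y : Type*} [MeasurableSpace Y]
  {ι κ τ : Type*} [Fintype ι] [Fintype κ] [Fintype τ]

/-- The entropy of the finite partition into the fibers of `p`, without normalizing the measure. -/
noncomputable def finEnt {Y ι : Type*} [MeasurableSpace Y] [Fintype ι] (μ : Measure Y)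
    (p : Y → ι) : ℝ :=
  ∑ i, negMulLog (μ.real (p ⁻¹' {i}))

theorem sum_measureReal_fiber_inter [MeasurableSpace κ] [MeasurableSingletonClass κ]
    (μ : Measure Y) [IsFiniteMeasure μ] {k : Y → κ}
    (hk : Measurable k) (A : Set Y) : ∑ t, μ.real (k ⁻¹' {t} ∩ A) = μ.real A := by
  have h := sum_measureReal_preimage_singleton (μ := μ.restrict A) (f := k) Finset.univ
    (fun t _ => hk (measurableSet_singleton t))
  simpa [measureReal_restrict_apply (hk (measurableSet_singleton _))] using h

theorem sum_measureReal_fiber [MeasurableSpace κ] [MeasurableSingletonClass κ]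
    (μ : Measure Y) [IsFiniteMeasure μ] {k : Y → κ}
    (hk : Measurable k) : ∑ t, μ.real (k ⁻¹' {t}) = μ.real Set.univ := by
  simpa using sum_measureReal_fiber_inter μ hk Set.univ

theorem sum_measureReal_restrict_fiber [MeasurableSpace κ] [MeasurableSingletonClass κ]
    (μ : Measure Y) [IsFiniteMeasure μ] {k : Y → κ}
    (hk : Measurable k) (A : Set Y) : ∑ t, (μ.restrict (k ⁻¹' {t})).real A = μ.real A := by
  rw [← sum_measureReal_fiber_inter μ hk A]
  refine Finset.sum_congr rfl fun t _ => ?_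
  rw [measureReal_restrict_apply' (hk (measurableSet_singleton t)), Set.inter_comm]

theorem preimage_pair_singleton {Y ι κ : Type*} (p : Y → ι) (q : Y → κ) (i : ι) (j : κ) :
    (fun x => (p x, q x)) ⁻¹' {(i, j)} = p ⁻¹' {i} ∩ q ⁻¹' {j} := by
  ext x
  simp

theorem finEnt_comp_injective (μ : Measure Y) (p : Y → ι) {e : ι → κ}
    (he : Function.Injective e) : finEnt μ (e ∘ p) = finEnt μ p := by
  classical
  unfold finEnt
  rw [← Finset.sum_subset (Finset.subset_univ (Finset.univ.image e)),
    Finset.sum_image he.injOn]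
  · refine Finset.sum_congr rfl fun i _ => ?_
    congr 3
    ext x
    simp [he.eq_iff]
  · intro j _ hj
    have : (e ∘ p) ⁻¹' {j} = ∅ := by
      ext x
      simp only [Set.mem_preimage, Function.comp_apply, Set.mem_singleton_iff,
        Set.mem_empty_iff_false, iff_false]
      rintro rfl
      exact hj (Finset.mem_image_of_mem e (Finset.mem_univ _))
    simp [this]

theorem finEnt_map [MeasurableSpace ι] [MeasurableSingletonClass ι]
    {Z : Type*} [MeasurableSpace Z] (μ : Measure Y) {φ : Y → Z}
    (hφ : Measurable φ) {p : Z → ι} (hp : Measurable p) :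
    finEnt (μ.map φ) p = finEnt μ (p ∘ φ) := by
  unfold finEnt
  refine Finset.sum_congr rfl fun i _ => ?_
  rw [map_measureReal_apply hφ (hp (measurableSet_singleton i))]
  rfl

theorem finEnt_nonneg (μ : Measure Y) [IsProbabilityMeasure μ] (p : Y → ι) :
    0 ≤ finEnt μ p :=
  Finset.sum_nonneg fun _ _ => negMulLog_nonneg measureReal_nonneg measureReal_le_one

theorem finEnt_le_log_card [MeasurableSpace ι] [MeasurableSingletonClass ι]
    (μ : Measure Y) [IsProbabilityMeasure μ] {p : Y → ι}
    (hp : Measurable p) : finEnt μ p ≤ log (Fintype.card ι) := by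
  have h := gibbs_inequality (Finset.univ : Finset ι) (m := fun i => μ.real (p ⁻¹' {i}))
    (w := fun _ => 1) (fun _ _ => measureReal_nonneg) (fun _ _ => zero_le_one)
    (fun _ _ _ => one_pos)
  rw [sum_measureReal_fiber μ hp] at h
  simpa [finEnt] using h

/-- Entropy is at most the total entropy of the restrictions to a finite partition. -/
theorem finEnt_le_sum_restrict [MeasurableSpace κ] [MeasurableSingletonClass κ]
    (μ : Measure Y) [IsFiniteMeasure μ] (p : Y → ι) {k : Y → κ}
    (hk : Measurable k) : finEnt μ p ≤ ∑ t, finEnt (μ.restrict (k ⁻¹' {t})) p := by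
  unfold finEnt
  rw [Finset.sum_comm]
  refine Finset.sum_le_sum fun i _ => ?_
  rw [← sum_measureReal_restrict_fiber μ hk (p ⁻¹' {i})]
  exact negMulLog_sum_le _ fun _ _ => measureReal_nonneg

theorem finEnt_le_finEnt_pair [MeasurableSpace κ] [MeasurableSingletonClass κ]
    (μ : Measure Y) [IsFiniteMeasure μ] (p : Y → ι) {q : Y → κ}
    (hq : Measurable q) : finEnt μ p ≤ finEnt μ fun x => (p x, q x) := by
  unfold finEnt
  rw [Fintype.sum_prod_type]
  refine Finset.sum_le_sum fun i _ => ?_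
  simp only [preimage_pair_singleton]
  rw [← sum_measureReal_fiber_inter μ hq (p ⁻¹' {i})]
  refine (negMulLog_sum_le _ fun _ _ => measureReal_nonneg).trans_eq ?_
  simp only [Set.inter_comm]

/-- Strong subadditivity of entropy. -/
theorem finEnt_strong_subadditive [MeasurableSpace ι] [MeasurableSingletonClass ι]
    [MeasurableSpace κ] [MeasurableSingletonClass κ]
    (μ : Measure Y) [IsFiniteMeasure μ] {p : Y → ι} {q : Y → κ}
    {r : Y → τ} (hp : Measurable p) (hq : Measurable q) :
    finEnt μ (fun x => (p x, q x, r x)) + finEnt μ r ≤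
      finEnt μ (fun x => (p x, r x)) + finEnt μ fun x => (q x, r x) := by
  have h := Finset.sum_le_sum fun (z : τ) (_ : z ∈ Finset.univ) => negMulLog_submodular
    (m := fun i j => μ.real (p ⁻¹' {i} ∩ (q ⁻¹' {j} ∩ r ⁻¹' {z}))) fun _ _ => measureReal_nonneg
  have e1 : ∀ j z, ∑ i, μ.real (p ⁻¹' {i} ∩ (q ⁻¹' {j} ∩ r ⁻¹' {z})) =
      μ.real (q ⁻¹' {j} ∩ r ⁻¹' {z}) := fun j z => sum_measureReal_fiber_inter μ hp _
  have e2 : ∀ i z, ∑ j, μ.real (p ⁻¹' {i} ∩ (q ⁻¹' {j} ∩ r ⁻¹' {z})) =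
      μ.real (p ⁻¹' {i} ∩ r ⁻¹' {z}) := by
    intro i z
    rw [← sum_measureReal_fiber_inter μ hq]
    refine Finset.sum_congr rfl fun j _ => ?_
    rw [Set.inter_left_comm]
  simp only [e1, e2, sum_measureReal_fiber_inter μ hp, Finset.sum_add_distrib] at h
  unfold finEnt
  simp only [Fintype.sum_prod_type, preimage_pair_singleton]
  have c1 : ∑ z, ∑ i, ∑ j, negMulLog (μ.real (p ⁻¹' {i} ∩ (q ⁻¹' {j} ∩ r ⁻¹' {z}))) =
      ∑ i, ∑ j, ∑ z, negMulLog (μ.real (p ⁻¹' {i} ∩ (q ⁻¹' {j} ∩ r ⁻¹' {z}))) := by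
    rw [Finset.sum_comm]
    exact Finset.sum_congr rfl fun i _ => Finset.sum_comm
  rw [c1, Finset.sum_comm (f := fun z i => negMulLog (μ.real (p ⁻¹' {i} ∩ r ⁻¹' {z}))),
    Finset.sum_comm (f := fun z j => negMulLog (μ.real (q ⁻¹' {j} ∩ r ⁻¹' {z})))] at h
  exact h

end FiniteEntropy

section Names

variable {G : Type} [Group G]

/-- The `F`-name of a point: its itinerary along `F` through the partition given by `p`. -/
def orbitName {κ : Type*} (S : GSystem G) (p : S.carrier → κ) (F : Finset G) (x : S.carrier) :
    F → κ :=
  fun g => p (S.act g x)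

theorem measurable_act (S : GSystem G) (g : G) : Measurable (S.act g) :=
  (S.cont_act g).measurable

theorem measurable_orbitName {κ : Type*} [MeasurableSpace κ] (S : GSystem G)
    {p : S.carrier → κ} (hp : Measurable p) (F : Finset G) : Measurable (orbitName S p F) :=
  measurable_pi_lambda _ fun g => hp.comp (measurable_act S g)

/-- Shearer's inequality for monotone submodular set functions. -/
theorem shearer_inequality {α β : Type*} [DecidableEq α] {φ : Finset α → ℝ} (h0 : φ ∅ = 0)
    (hmono : ∀ h A, φ A ≤ φ (insert h A))
    (hsub : ∀ h A B, B ⊆ A → h ∉ A → φ (insert h A) - φ A ≤ φ (insert h B) - φ B)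
    (I : Finset β) (A : β → Finset α) (k : ℕ) (F : Finset α)
    (hk : ∀ h ∈ F, k ≤ (I.filter fun i => h ∈ A i).card) :
    k * φ F ≤ ∑ i ∈ I, φ (A i ∩ F) := by
  induction F using Finset.induction_on with
  | empty => simp [h0]
  | insert h F hh ih =>
    have ih := ih fun g hg => hk g (Finset.mem_insert_of_mem hg)
    have hterm : ∀ i ∈ I, φ (A i ∩ F) + (if h ∈ A i then φ (insert h F) - φ F else 0) ≤
        φ (A i ∩ insert h F) := by
      intro i _
      split_ifs with hi
      · rw [Finset.inter_insert_of_mem hi]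
        have := hsub h F (A i ∩ F) Finset.inter_subset_right hh
        linarith
      · rw [Finset.inter_insert_of_notMem hi, add_zero]
    have hsum := Finset.sum_le_sum hterm
    rw [Finset.sum_add_distrib, ← Finset.sum_filter, Finset.sum_const, nsmul_eq_mul] at hsum
    have hcard : (k : ℝ) ≤ ((I.filter fun i => h ∈ A i).card : ℝ) := by
      exact_mod_cast hk h (Finset.mem_insert_self h F)
    have := mul_le_mul_of_nonneg_right hcard (sub_nonneg.2 (hmono h F))
    linarith

variable {κ : Type*} [Fintype κ]

theorem finEnt_orbitName_insert [DecidableEq G] (S : GSystem G) (μ : Measure S.carrier)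
    (p : S.carrier → κ) (A : Finset G) (h : G) :
    finEnt μ (orbitName S p (insert h A)) =
      finEnt μ fun x => (p (S.act h x), orbitName S p A x) := by
  let e : (↥(insert h A) → κ) → κ × (A → κ) := fun s =>
    (s ⟨h, Finset.mem_insert_self h A⟩, fun g => s ⟨g.1, Finset.mem_insert_of_mem g.2⟩)
  have he : Function.Injective e := by
    intro s t hst
    obtain ⟨h1, h2⟩ := Prod.mk.inj hst
    ext ⟨g, hg⟩
    rcases Finset.mem_insert.1 hg with rfl | hg'
    · exact h1
    · exact congrFun h2 ⟨g, hg'⟩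
  rw [← finEnt_comp_injective μ (orbitName S p (insert h A)) he]
  rfl

variable [MeasurableSpace κ] [MeasurableSingletonClass κ]

theorem finEnt_orbitName_mono [DecidableEq G] (S : GSystem G) (μ : Measure S.carrier)
    [IsProbabilityMeasure μ] {p : S.carrier → κ} (hp : Measurable p) (h : G) (A : Finset G) :
    finEnt μ (orbitName S p A) ≤ finEnt μ (orbitName S p (insert h A)) := by
  rw [finEnt_orbitName_insert,
    ← finEnt_comp_injective μ (fun x => (p (S.act h x), orbitName S p A x)) Prod.swap_injective]
  exact finEnt_le_finEnt_pair μ (orbitName S p A) (hp.comp (measurable_act S h))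

theorem finEnt_orbitName_submodular [DecidableEq G] (S : GSystem G) (μ : Measure S.carrier)
    [IsProbabilityMeasure μ] {p : S.carrier → κ} (hp : Measurable p) (h : G) (A B : Finset G)
    (hBA : B ⊆ A) :
    finEnt μ (orbitName S p (insert h A)) - finEnt μ (orbitName S p A) ≤
      finEnt μ (orbitName S p (insert h B)) - finEnt μ (orbitName S p B) := by
  have hss := finEnt_strong_subadditive μ (r := orbitName S p B)
    (hp.comp (measurable_act S h)) (measurable_orbitName S hp A)
  let res : (A → κ) → (B → κ) := fun s g => s ⟨g, hBA g.2⟩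
  have e1 : finEnt μ (fun x => (orbitName S p A x, orbitName S p B x)) =
      finEnt μ (orbitName S p A) :=
    finEnt_comp_injective μ (orbitName S p A) (e := fun s => (s, res s))
      fun s t hst => (Prod.mk.inj hst).1
  have e2 : finEnt μ (fun x => ((p ∘ S.act h) x, orbitName S p A x, orbitName S p B x)) =
      finEnt μ (fun x => (p (S.act h x), orbitName S p A x)) := by
    refine finEnt_comp_injective μ (fun x => (p (S.act h x), orbitName S p A x))
      (e := fun s => (s.1, s.2, res s.2)) fun s t hst => ?_
    obtain ⟨h1, h2⟩ := Prod.mk.inj hst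
    exact Prod.ext h1 (Prod.mk.inj h2).1
  rw [e1, e2] at hss
  rw [finEnt_orbitName_insert, finEnt_orbitName_insert]
  simp only [Function.comp_apply] at hss
  linarith

theorem finEnt_orbitName_translate [DecidableEq G] (S : GSystem G) {μ : Measure S.carrier}
    (hμ : IsInvProb S μ) {p : S.carrier → κ} (hp : Measurable p) (A : Finset G) (h : G) :
    finEnt μ (orbitName S p (A.image (· * h))) = finEnt μ (orbitName S p A) := by
  let e : (↥(A.image (· * h)) → κ) → (A → κ) := fun s g =>
    s ⟨g * h, Finset.mem_image_of_mem _ g.2⟩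
  have he : Function.Injective e := by
    intro s t hst
    ext ⟨g, hg⟩
    obtain ⟨g', hg', rfl⟩ := Finset.mem_image.1 hg
    exact congrFun hst ⟨g', hg'⟩
  conv_rhs => rw [← hμ.2 h]
  rw [finEnt_map μ (measurable_act S h) (measurable_orbitName S hp A),
    ← finEnt_comp_injective μ _ he]
  congr 1
  ext x g
  simp [e, orbitName, S.mul_act]

/-- A finite form of the Ornstein–Weiss lemma for entropy. -/
theorem card_mul_finEnt_orbitName_le [DecidableEq G] (S : GSystem G) {μ : Measure S.carrier}
    (hμ : IsInvProb S μ) {p : S.carrier → κ} (hp : Measurable p) (E F : Finset G) :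
    E.card * finEnt μ (orbitName S p F) ≤ F.card * finEnt μ (orbitName S p E) +
      (folnerB G F E).ncard * (E.card * log (Fintype.card κ)) := by
  have : IsProbabilityMeasure μ := hμ.1
  rcases E.eq_empty_or_nonempty with rfl | ⟨e₀, he₀⟩
  · have := finEnt_nonneg μ (orbitName S p ∅)
    simp only [Finset.card_empty, CharP.cast_eq_zero, zero_mul, mul_zero, add_zero]
    positivity
  set I : Finset G := (E ×ˢ F).image fun q => q.1⁻¹ * q.2 with hI
  have hmemI : ∀ g, g ∈ I ↔ ∃ e ∈ E, e * g ∈ F := by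
    intro g
    simp only [hI, Finset.mem_image, Finset.mem_product, Prod.exists]
    constructor
    · rintro ⟨e, f, ⟨he, hf⟩, rfl⟩
      exact ⟨e, he, by simpa using hf⟩
    · rintro ⟨e, he, hf⟩
      exact ⟨e, e * g, ⟨he, hf⟩, by simp⟩
  have hcover : ∀ h ∈ F, E.card ≤ (I.filter fun g => h ∈ E.image (· * g)).card := by
    intro h hh
    refine Finset.card_le_card_of_injOn (fun e => e⁻¹ * h) ?_ ?_
    · intro e he
      simp only [Finset.coe_filter, Set.mem_ofPred_eq, Finset.mem_image]
      exact ⟨(hmemI _).2 ⟨e, he, by simpa using hh⟩, e, he, by simp⟩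
    · intro e _ e' _ hee
      simpa using hee
  have hempty : finEnt μ (orbitName S p ∅) = 0 := by
    refine le_antisymm ?_ (finEnt_nonneg _ _)
    have h := finEnt_le_log_card μ (measurable_orbitName S hp ∅)
    simpa using h
  have hsh := shearer_inequality (φ := fun A => finEnt μ (orbitName S p A)) hempty
    (fun h A => finEnt_orbitName_mono S μ hp h A)
    (fun h A B hBA _ => finEnt_orbitName_submodular S μ hp h A B hBA)
    I (fun g => E.image (· * g)) E.card F hcover
  refine hsh.trans ?_
  have hlog : 0 ≤ log (Fintype.card κ) := log_natCast_nonneg _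
  rw [← Finset.sum_filter_add_sum_filter_not I fun g => ∀ e ∈ E, e * g ∈ F]
  refine add_le_add ?_ ?_
  · have hle : ∀ g ∈ I.filter (fun g => ∀ e ∈ E, e * g ∈ F),
        finEnt μ (orbitName S p (E.image (· * g) ∩ F)) ≤ finEnt μ (orbitName S p E) := by
      intro g hg
      have hsub : E.image (· * g) ⊆ F := by
        intro x hx
        obtain ⟨e, he, rfl⟩ := Finset.mem_image.1 hx
        exact (Finset.mem_filter.1 hg).2 e he
      rw [Finset.inter_eq_left.2 hsub, finEnt_orbitName_translate S hμ hp]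
    refine (Finset.sum_le_card_nsmul _ _ _ hle).trans ?_
    rw [nsmul_eq_mul]
    refine mul_le_mul_of_nonneg_right ?_ (finEnt_nonneg _ _)
    have : (I.filter fun g => ∀ e ∈ E, e * g ∈ F).card ≤ F.card :=
      Finset.card_le_card_of_injOn (fun g => e₀ * g)
        (fun g hg => (Finset.mem_filter.1 hg).2 e₀ he₀) fun g _ g' _ h => by simpa using h
    exact_mod_cast this
  · have hle : ∀ g ∈ I.filter (fun g => ¬∀ e ∈ E, e * g ∈ F),
        finEnt μ (orbitName S p (E.image (· * g) ∩ F)) ≤ E.card * log (Fintype.card κ) := by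
      intro g _
      refine (finEnt_le_log_card μ (measurable_orbitName S hp _)).trans ?_
      rw [Fintype.card_fun, Nat.cast_pow, log_pow, Fintype.card_coe]
      refine mul_le_mul_of_nonneg_right ?_ hlog
      exact_mod_cast (Finset.card_le_card Finset.inter_subset_left).trans Finset.card_image_le
    refine (Finset.sum_le_card_nsmul _ _ _ hle).trans ?_
    rw [nsmul_eq_mul]
    refine mul_le_mul_of_nonneg_right ?_ (by positivity)
    have hset : ((I.filter fun g => ¬∀ e ∈ E, e * g ∈ F : Finset G) : Set G) = folnerB G F E := by
      ext g
      simp [folnerB, hmemI]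
    rw [← hset, Set.ncard_coe_finset]

theorem Hpart_orbitName_eq [DecidableEq G] (S : GSystem G) (μ : Measure S.carrier) {p : S.carrier → ℕ} {N : ℕ}
    (q : S.carrier → Fin N) (hq : ∀ x, (q x : ℕ) = p x) (F : Finset G) :
    Hpart μ (fun x => fun g : F => p (S.act (g : G) x)) = finEnt μ (orbitName S q F) := by
  let e : (F → Fin N) → (F → ℕ) := fun s g => s g
  have he : Function.Injective e := fun s t hst => funext fun g => Fin.ext (congrFun hst g)
  have hcomp : (fun x => fun g : F => p (S.act (g : G) x)) = e ∘ orbitName S q F := by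
    ext x g
    simp [e, orbitName, hq]
  unfold Hpart
  rw [hcomp, ← he.tsum_eq, tsum_fintype]
  · unfold finEnt
    refine Finset.sum_congr rfl fun i _ => ?_
    rw [Set.preimage_comp, ← Set.image_singleton, Set.preimage_image_eq _ he]
    rfl
  · intro s hs
    by_contra hne
    refine hs ?_
    have : e ∘ orbitName S q F ⁻¹' {s} = ∅ := by
      ext x
      simp only [Set.mem_preimage, Function.comp_apply, Set.mem_singleton_iff,
        Set.mem_empty_iff_false, iff_false]
      rintro rfl
      exact hne ⟨_, rfl⟩
    simp [this]

/-- The entropy of a partition is at most its average entropy over any finite set. -/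
theorem hSeq_mul_card_le [DecidableEq G] {Fn : ℕ → Finset G} (hFn : IsFolner G Fn) (S : GSystem G)
    {μ : Measure S.carrier} (hμ : IsInvProb S μ) {p : S.carrier → ℕ} {N : ℕ}
    {q : S.carrier → Fin N} (hqm : Measurable q) (hq : ∀ x, (q x : ℕ) = p x) {E : Finset G}
    (hE : E.Nonempty) :
    hSeq S Fn μ p * E.card ≤ finEnt μ (orbitName S q E) := by
  have : IsProbabilityMeasure μ := hμ.1
  have hEc : (0 : ℝ) < E.card := by exact_mod_cast hE.card_pos
  rw [← le_div_iff₀ hEc]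
  unfold hSeq
  simp only [Hpart_orbitName_eq S μ q hq]
  have hlim : Tendsto (fun n => finEnt μ (orbitName S q E) / E.card +
      ((folnerB G (Fn n) E).ncard : ℝ) / (Fn n).card * log (Fintype.card (Fin N))) atTop
      (nhds (finEnt μ (orbitName S q E) / E.card)) := by
    simpa using ((hFn.2 E hE).mul_const (log (Fintype.card (Fin N)))).const_add
      (finEnt μ (orbitName S q E) / E.card)
  refine (limsup_le_limsup (Eventually.of_forall fun n => ?_) ?_ ?_).trans_eq hlim.limsup_eq
  · have hc : (0 : ℝ) < (Fn n).card := by exact_mod_cast (hFn.1 n).card_pos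
    have h := card_mul_finEnt_orbitName_le S hμ hqm E (Fn n)
    rw [div_le_iff₀ hc, ← mul_le_mul_iff_right₀ hEc]
    refine h.trans_eq ?_
    field_simp
  · refine IsBoundedUnder.isCoboundedUnder_le ⟨0, ?_⟩
    rw [eventually_map]
    exact Eventually.of_forall fun n => div_nonneg (finEnt_nonneg _ _) (Nat.cast_nonneg _)
  · exact hlim.isBoundedUnder_le

end Names

section Covers

/-- The total penalty of a name whose letters carry a marker: each marked letter contributes
`-M`. -/
noncomputable def penalty {α κ : Type*} [Fintype α] (M : ℝ) (s : α → κ × Bool) : ℝ :=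
  ∑ g, if (s g).2 then -M else 0

variable {G : Type} [Group G] [DecidableEq G]

theorem dist_act_lt_of_diamLT {G : Type} [Group G] {S : GSystem G} {F : Finset G}
    {U : Set S.carrier} {ε : ℝ} (hU : diamLT S F U ε) {x y : S.carrier} (hx : x ∈ U) (hy : y ∈ U)
    {g : G} (hg : g ∈ F) : dist (S.act g x) (S.act g y) < ε := by
  refine lt_of_le_of_lt ?_ (hU x hx y hy)
  rw [dist_nndist]
  exact_mod_cast Finset.le_sup (f := fun g => nndist (S.act g x) (S.act g y)) hg

theorem exists_open_cover_diamLT {G : Type} [Group G] (S : GSystem G) (F : Finset G)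
    (Ω : Set S.carrier) {ε : ℝ} (hε : 0 < ε) :
    ∃ (n : ℕ) (U : Fin n → Set S.carrier),
      (∀ j, IsOpen (U j)) ∧ (Ω ⊆ ⋃ j, U j) ∧ ∀ j, diamLT S F (U j) ε := by
  let V : S.carrier → Set S.carrier := fun x =>
    ⋂ g ∈ F, S.act g ⁻¹' Metric.ball (S.act g x) (ε / 2)
  have hopen : ∀ x, IsOpen (V x) := fun x =>
    isOpen_biInter_finset fun g _ => Metric.isOpen_ball.preimage (S.cont_act g)
  have hmem : ∀ x, x ∈ V x := fun x => by simp [V, hε]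
  have hdiam : ∀ x, diamLT S F (V x) ε := by
    intro x y hy z hz
    have hlt : F.sup (fun g => nndist (S.act g y) (S.act g z)) < ε.toNNReal := by
      rw [Finset.sup_lt_iff (by simpa using hε)]
      intro g hg
      have h1 : dist (S.act g y) (S.act g x) < ε / 2 := Set.mem_iInter₂.1 hy g hg
      have h2 : dist (S.act g z) (S.act g x) < ε / 2 := Set.mem_iInter₂.1 hz g hg
      have h3 := dist_triangle_right (S.act g y) (S.act g z) (S.act g x)
      rw [Real.lt_toNNReal_iff_coe_lt, coe_nndist]
      exact h3.trans_lt (by linarith)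
    exact Real.lt_toNNReal_iff_coe_lt.1 hlt
  obtain ⟨t, ht⟩ := isCompact_univ.elim_finite_subcover V hopen fun x _ =>
    Set.mem_iUnion.2 ⟨x, hmem x⟩
  refine ⟨t.card, fun j => V (t.equivFin.symm j), fun j => hopen _, fun x _ => ?_,
    fun j => hdiam _⟩
  obtain ⟨y, hy, hxy⟩ := Set.mem_iUnion₂.1 (ht (Set.mem_univ x))
  exact Set.mem_iUnion.2 ⟨t.equivFin ⟨y, hy⟩, by simpa using hxy⟩

/-- The names realized in a set of small dynamical diameter have small total weight. -/
theorem sum_exp_penalty_le (S : GSystem G) {N : ℕ} {ℓ : S.carrier → Fin N × Bool} (M : ℝ) {ε : ℝ}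
    (hℓ : ∀ x y, dist x y < ε → (ℓ x).2 = false → (ℓ y).2 = false → ℓ x = ℓ y) (F : Finset G)
    {U : Set S.carrier} (hU : diamLT S F U ε) (T : Finset (F → Fin N × Bool))
    (hT : ∀ s ∈ T, ∃ x ∈ U, orbitName S ℓ F x = s) :
    ∑ s ∈ T, exp (penalty M s) ≤ (1 + N * exp (-M)) ^ F.card := by
  classical
  let L : F → Finset (Fin N × Bool) := fun g =>
    Finset.univ.filter fun l => ∃ x ∈ U, ℓ (S.act g x) = l
  have hTL : T ⊆ Fintype.piFinset L := by
    intro s hs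
    obtain ⟨x, hx, rfl⟩ := hT s hs
    exact Fintype.mem_piFinset.2 fun g => Finset.mem_filter.2 ⟨Finset.mem_univ _, x, hx, rfl⟩
  refine (Finset.sum_le_sum_of_subset_of_nonneg hTL fun _ _ _ => (exp_pos _).le).trans ?_
  have hprod : ∀ s : F → Fin N × Bool,
      exp (penalty M s) = ∏ g, exp (if (s g).2 then -M else 0) := fun s => exp_sum _ _
  simp only [hprod]
  rw [← Finset.prod_univ_sum L fun _ l => exp (if l.2 then -M else 0)]
  have hfac : ∀ g : F, ∑ l ∈ L g, exp (if l.2 then -M else 0) ≤ 1 + N * exp (-M) := by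
    intro g
    rw [← Finset.sum_filter_add_sum_filter_not (L g) (fun l => l.2 = true), add_comm]
    refine add_le_add ?_ ?_
    · have hcard : ((L g).filter fun l => ¬l.2 = true).card ≤ 1 := by
        refine Finset.card_le_one.2 fun l hl l' hl' => ?_
        simp only [Finset.mem_filter, L, Finset.mem_univ, true_and, Bool.not_eq_true] at hl hl'
        obtain ⟨⟨x, hx, rfl⟩, h1⟩ := hl
        obtain ⟨⟨y, hy, rfl⟩, h2⟩ := hl'
        exact hℓ _ _ (dist_act_lt_of_diamLT hU hx hy g.2) h1 h2
      have hone : ∀ l ∈ (L g).filter (fun l => ¬l.2 = true),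
          exp (if l.2 then -M else 0) ≤ 1 := by
        intro l hl
        simp [(Finset.mem_filter.1 hl).2]
      refine (Finset.sum_le_card_nsmul _ _ _ hone).trans ?_
      simpa using hcard
    · have hcard : ((L g).filter fun l => l.2 = true).card ≤ N := by
        calc ((L g).filter fun l => l.2 = true).card ≤ (Finset.univ : Finset (Fin N)).card := by
              refine Finset.card_le_card_of_injOn Prod.fst (fun _ _ => Finset.mem_univ _) ?_
              intro l hl l' hl' h
              have h1 := (Finset.mem_filter.1 hl).2
              have h2 := (Finset.mem_filter.1 hl').2
              exact Prod.ext h (h1.trans h2.symm)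
          _ = N := by simp
      have hle : ∀ l ∈ (L g).filter (fun l => l.2 = true),
          exp (if l.2 then -M else 0) ≤ exp (-M) := by
        intro l hl
        simp [(Finset.mem_filter.1 hl).2]
      refine (Finset.sum_le_card_nsmul _ _ _ hle).trans ?_
      rw [nsmul_eq_mul]
      exact mul_le_mul_of_nonneg_right (by exact_mod_cast hcard) (exp_pos _).le
  refine (Finset.prod_le_prod (fun g _ => Finset.sum_nonneg fun _ _ => (exp_pos _).le)
    fun g _ => hfac g).trans ?_
  simp

theorem exists_measurable_index {Y ι : Type*} [MeasurableSpace Y] [Finite ι] [Nonempty ι]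
    [MeasurableSpace ι] {A : ι → Set Y} (hA : ∀ i, MeasurableSet (A i)) :
    ∃ c : Y → ι, Measurable c ∧ ∀ y ∈ ⋃ i, A i, y ∈ A (c y) := by
  classical
  have := Fintype.ofFinite ι
  have key : ∀ s : Finset ι, ∃ c : Y → ι, Measurable c ∧ ∀ i ∈ s, ∀ y ∈ A i, y ∈ A (c y) := by
    intro s
    induction s using Finset.induction_on with
    | empty => exact ⟨fun _ => Classical.arbitrary ι, measurable_const, by simp⟩
    | insert j s _ ih =>
      obtain ⟨c, hc, hcA⟩ := ih
      refine ⟨(A j).piecewise (fun _ => j) c, measurable_const.piecewise (hA j) hc, ?_⟩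
      intro i hi y hy
      by_cases hj : y ∈ A j
      · simp [hj]
      · rcases Finset.mem_insert.1 hi with rfl | hi
        · exact absurd hy hj
        · simpa [hj] using hcA i hi y hy
  obtain ⟨c, hc, hcA⟩ := key Finset.univ
  refine ⟨c, hc, fun y hy => ?_⟩
  obtain ⟨i, hi⟩ := Set.mem_iUnion.1 hy
  exact hcA i (Finset.mem_univ i) y hi

/-- The variational estimate for a partition together with an index into a finite family. -/
theorem exp_finEnt_add_le {Y σ J : Type*} [MeasurableSpace Y] [Fintype σ] [MeasurableSpace σ]
    [MeasurableSingletonClass σ] [Fintype J] [MeasurableSpace J] [MeasurableSingletonClass J]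
    (ν : Measure Y) [IsFiniteMeasure ν] (hν : 0 < ν.real Set.univ) {b : Y → σ} (hb : Measurable b)
    {c : Y → J} (hc : Measurable c) (u : σ → ℝ) (T : J → Finset σ) {Z : ℝ}
    (hZ : ∀ j, ∑ s ∈ T j, exp (u s) ≤ Z) {C : J → ℝ} (hC : ∀ j, 0 ≤ C j)
    (hT : ∀ t : σ × J, 0 < ν.real ((fun y => (b y, c y)) ⁻¹' {t}) → t.1 ∈ T t.2)
    {a : ℝ} (ha : a ∈ Set.Icc (0 : ℝ) 1) {R : ℝ} {R' : σ × J → ℝ} (hR : R ≤ ∑ t, R' t)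
    (hR' : ∀ t, 0 < ν.real ((fun y => (b y, c y)) ⁻¹' {t}) → 0 < C t.2 ∧
      R' t ≤ a * negMulLog (ν.real ((fun y => (b y, c y)) ⁻¹' {t})) +
        ν.real ((fun y => (b y, c y)) ⁻¹' {t}) * log (C t.2))
    (hR0 : ∀ t, ν.real ((fun y => (b y, c y)) ⁻¹' {t}) = 0 → R' t ≤ 0) :
    exp (((1 - a) * finEnt ν b + ∑ s, ν.real (b ⁻¹' {s}) * u s + R -
      negMulLog (ν.real Set.univ)) / ν.real Set.univ) ≤ Z * ∑ j, C j := by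
  classical
  set k : Y → σ × J := fun y => (b y, c y) with hk
  have hkm : Measurable k := hb.prodMk hc
  set m : σ × J → ℝ := fun t => ν.real (k ⁻¹' {t}) with hm
  have hm0 : ∀ t, 0 ≤ m t := fun t => measureReal_nonneg
  have hmsum : ∑ t, m t = ν.real Set.univ := sum_measureReal_fiber ν hkm
  set w : σ × J → ℝ := fun t => if t.1 ∈ T t.2 then exp (u t.1) * C t.2 else 0 with hw
  have hw0 : ∀ t, 0 ≤ w t := by
    intro t
    simp only [hw]
    split_ifs
    · exact mul_nonneg (exp_pos _).le (hC _)
    · exact le_rfl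
  have hwm : ∀ t, 0 < m t → w t = exp (u t.1) * C t.2 := fun t ht => if_pos (hT t ht)
  have hwpos : ∀ t, 0 < m t → 0 < w t := fun t ht => by
    rw [hwm t ht]
    exact mul_pos (exp_pos _) (hR' t ht).1
  have hG := gibbs_inequality Finset.univ (fun t _ => hm0 t) (fun t _ => hw0 t)
    fun t _ => hwpos t
  rw [hmsum] at hG
  have hWpos : 0 < ∑ t, w t := by
    obtain ⟨t, ht⟩ : ∃ t, 0 < m t := by
      by_contra! h
      exact absurd (Finset.sum_nonpos fun t (_ : t ∈ Finset.univ) => h t)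
        (not_le.2 (hmsum ▸ hν))
    exact (hwpos t ht).trans_le
      (Finset.single_le_sum (fun t _ => hw0 t) (Finset.mem_univ t))
  have hWle : ∑ t, w t ≤ Z * ∑ j, C j := by
    rw [Fintype.sum_prod_type, Finset.sum_comm, Finset.mul_sum]
    refine Finset.sum_le_sum fun j _ => ?_
    simp only [hw]
    rw [← Finset.sum_filter, ← Finset.sum_mul]
    simp only [Finset.filter_univ_mem]
    exact mul_le_mul_of_nonneg_right (hZ j) (hC j)
  have hH : finEnt ν b ≤ ∑ t, negMulLog (m t) := finEnt_le_finEnt_pair ν b hc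
  have hu : ∑ s, ν.real (b ⁻¹' {s}) * u s = ∑ t, m t * u t.1 := by
    rw [Fintype.sum_prod_type]
    refine Finset.sum_congr rfl fun s _ => ?_
    rw [← sum_measureReal_fiber_inter ν hc (b ⁻¹' {s}), Finset.sum_mul]
    refine Finset.sum_congr rfl fun j _ => ?_
    simp only [hm, hk, preimage_pair_singleton]
    rw [Set.inter_comm]
  have hterm : ∀ t, (1 - a) * negMulLog (m t) + m t * u t.1 + R' t ≤
      negMulLog (m t) + m t * log (w t) := by
    intro t
    rcases (hm0 t).eq_or_lt with h | h
    · have := hR0 t h.symm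
      simpa [← h] using this
    · have h1 := (hR' t h).2
      rw [hwm t h, log_mul (exp_pos _).ne' (hR' t h).1.ne', log_exp]
      change R' t ≤ a * negMulLog (m t) + m t * log (C t.2) at h1
      linarith
  have hsum := Finset.sum_le_sum fun t (_ : t ∈ Finset.univ) => hterm t
  rw [Finset.sum_add_distrib, Finset.sum_add_distrib, ← Finset.mul_sum] at hsum
  have hH' := mul_le_mul_of_nonneg_left hH (sub_nonneg.2 ha.2)
  refine le_trans ?_ hWle
  rw [← le_log_iff_exp_le hWpos, div_le_iff₀ hν]
  linarith

/-- The variational estimate for the infimum over covers of small dynamical diameter. -/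
theorem exp_finEnt_add_le_sInf_cover {Y : Type*} [MeasurableSpace Y] (S : GSystem G)
    {F : Finset G} {ε : ℝ} (hε : 0 < ε) {Ω : Set S.carrier} {W : Set S.carrier → ℝ}
    {φ : Y → S.carrier} (hφ : Measurable φ) (ν : Measure Y) [IsFiniteMeasure ν]
    (hν : 0 < ν.real Set.univ) (hνΩ : ν (φ ⁻¹' Ωᶜ) = 0) {N : ℕ} {ℓ : S.carrier → Fin N × Bool}
    (hℓm : Measurable ℓ) {M : ℝ}
    (hℓ : ∀ x y, dist x y < ε → (ℓ x).2 = false → (ℓ y).2 = false → ℓ x = ℓ y)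
    {B D : ℝ} (hB : 0 < B) (hD : 0 < D) (hNB : (1 + N * exp (-M)) ^ F.card ≤ B)
    {a : ℝ} (ha : a ∈ Set.Icc (0 : ℝ) 1) {C : Set S.carrier → ℝ} (hC : ∀ U, 0 ≤ C U)
    (hCW : ∀ U, C U ≤ D * W U) {R : Measure Y → ℝ} (hR0 : R 0 ≤ 0)
    (hR : ∀ (n : ℕ) (k : Y → (F → Fin N × Bool) × Fin n), Measurable k →
      R ν ≤ ∑ t, R (ν.restrict (k ⁻¹' {t})))
    (hRC : ∀ U, IsOpen U → ∀ ν' : Measure Y, IsFiniteMeasure ν' → 0 < ν'.real Set.univ →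
      ν' (φ ⁻¹' Uᶜ) = 0 → 0 < C U ∧
        R ν' ≤ a * negMulLog (ν'.real Set.univ) + ν'.real Set.univ * log (C U)) :
    exp (((1 - a) * finEnt ν (orbitName S ℓ F ∘ φ) +
      ∑ s, ν.real ((orbitName S ℓ F ∘ φ) ⁻¹' {s}) * penalty M s + R ν -
      negMulLog (ν.real Set.univ)) / ν.real Set.univ) ≤
      B * D * sInf {s | ∃ (n : ℕ) (U : Fin n → Set S.carrier), (∀ j, IsOpen (U j)) ∧
        (Ω ⊆ ⋃ j, U j) ∧ (∀ j, diamLT S F (U j) ε) ∧ s = ∑ j, W (U j)} := by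
  classical
  rw [← div_le_iff₀' (mul_pos hB hD)]
  refine le_csInf ?_ ?_
  · obtain ⟨n, U, h1, h2, h3⟩ := exists_open_cover_diamLT S F Ω hε
    exact ⟨_, n, U, h1, h2, h3, rfl⟩
  rintro _ ⟨n, U, hUo, hΩU, hUd, rfl⟩
  rw [div_le_iff₀' (mul_pos hB hD)]
  set b := orbitName S ℓ F ∘ φ with hb
  have hbm : Measurable b := (measurable_orbitName S hℓm F).comp hφ
  have hcov : ∀ y, y ∉ φ ⁻¹' Ωᶜ → ∃ j, φ y ∈ U j := by
    intro y hy
    exact Set.mem_iUnion.1 (hΩU (by simpa using hy))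
  have hn : Nonempty (Fin n) := by
    by_contra hne
    have : φ ⁻¹' Ωᶜ = Set.univ := by
      refine Set.eq_univ_of_forall fun y => ?_
      by_contra hy
      obtain ⟨j, _⟩ := hcov y hy
      exact hne ⟨j⟩
    rw [this] at hνΩ
    simp [Measure.real, hνΩ] at hν
  obtain ⟨c, hcm, hc⟩ := exists_measurable_index (A := fun j => φ ⁻¹' U j)
    fun j => hφ (hUo j).measurableSet
  have hc' : ∀ y, y ∉ φ ⁻¹' Ωᶜ → φ y ∈ U (c y) := by
    intro y hy
    obtain ⟨j, hj⟩ := hcov y hy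
    exact hc y (Set.mem_iUnion.2 ⟨j, hj⟩)
  set k : Y → (F → Fin N × Bool) × Fin n := fun y => (b y, c y) with hk
  have hkm : Measurable k := hbm.prodMk hcm
  have hkt : ∀ t, MeasurableSet (k ⁻¹' {t}) := fun t => hkm (measurableSet_singleton t)
  have hrestr : ∀ t, (ν.restrict (k ⁻¹' {t})).real Set.univ = ν.real (k ⁻¹' {t}) := by
    intro t
    simp [measureReal_restrict_apply MeasurableSet.univ]
  have hmain := exp_finEnt_add_le ν hν hbm hcm (penalty M)
    (fun j => Finset.univ.filter fun s => ∃ x ∈ U j, orbitName S ℓ F x = s)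
    (Z := B) (C := fun j => C (U j)) (a := a) (R := R ν)
    (R' := fun t => R (ν.restrict (k ⁻¹' {t})))
    (fun j => (sum_exp_penalty_le S M hℓ F (hUd j) _ fun s hs => (Finset.mem_filter.1 hs).2).trans
      hNB) (fun j => hC _) ?_ ha (hR n k hkm) ?_ ?_
  · refine hmain.trans ?_
    rw [mul_assoc, Finset.mul_sum Finset.univ _ D]
    exact mul_le_mul_of_nonneg_left (Finset.sum_le_sum fun j _ => hCW _) hB.le
  · intro t ht
    obtain ⟨y, hy, hyΩ⟩ : ∃ y ∈ k ⁻¹' {t}, y ∉ φ ⁻¹' Ωᶜ := by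
      by_contra! h
      have : ν (k ⁻¹' {t}) = 0 := measure_mono_null h hνΩ
      simp [← hk, Measure.real, this] at ht
    have hyt : k y = t := hy
    subst hyt
    exact Finset.mem_filter.2 ⟨Finset.mem_univ _, φ y, hc' y hyΩ, rfl⟩
  · intro t ht
    rw [← hrestr t] at ht ⊢
    refine hRC (U t.2) (hUo _) _ inferInstance ht ?_
    rw [Measure.restrict_apply (hφ (hUo _).isClosed_compl.measurableSet)]
    refine measure_mono_null ?_ hνΩ
    rintro y ⟨hy1, hy2⟩
    by_contra hyΩ
    have hyt : k y = t := hy2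
    subst hyt
    exact hy1 (hc' y hyΩ)
  · intro t ht
    have : ν.restrict (k ⁻¹' {t}) = 0 := by
      rw [Measure.restrict_eq_zero]
      exact (measureReal_eq_zero_iff).1 ht
    simp only [this, hR0]

end Covers

section WeightedEntropy

variable {G : Type} [Group G] [DecidableEq G] (X : ℕ → GSystem G)
  (π : ∀ i, FactorMap (X i) (X (i + 1))) (a : ℕ → ℝ) (f : (X 0).carrier → ℝ) (F : Finset G)
  {N : ℕ → ℕ} (ℓ : ∀ i, (X i).carrier → Fin (N i) × Bool) (M : ℕ → ℝ)

theorem continuous_chainMap {G : Type} [Group G] (X : ℕ → GSystem G)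
    (π : ∀ i, FactorMap (X i) (X (i + 1))) : ∀ i, Continuous (chainMap X π i)
  | 0 => continuous_id
  | i + 1 => (π i).cont.comp (continuous_chainMap X π i)

theorem chainMap_act {G : Type} [Group G] (X : ℕ → GSystem G)
    (π : ∀ i, FactorMap (X i) (X (i + 1))) (g : G) :
    ∀ i x, chainMap X π i ((X 0).act g x) = (X i).act g (chainMap X π i x)
  | 0, _ => rfl
  | i + 1, x => by
    change (π i).toFun (chainMap X π i ((X 0).act g x)) = _
    rw [chainMap_act X π g i x, (π i).equiv]
    rfl

theorem continuous_birk {G : Type} [Group G] (S : GSystem G) {f : S.carrier → ℝ}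
    (hf : Continuous f) (F : Finset G) : Continuous (birk S f F) :=
  continuous_finsetSum _ fun g _ => hf.comp (S.cont_act g)

theorem integrable_of_continuous {Z : Type*} [TopologicalSpace Z] [CompactSpace Z]
    [MeasurableSpace Z] [OpensMeasurableSpace Z] (μ : Measure Z) [IsFiniteMeasure μ] {h : Z → ℝ}
    (hh : Continuous h) : Integrable h μ :=
  hh.integrable_of_hasCompactSupport (HasCompactSupport.of_compactSpace h)

/-- The `F`-name of the `i`-th coordinate of a point of the top system. -/
noncomputable def chainName (i : ℕ) : (X 0).carrier → F → Fin (N i) × Bool :=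
  orbitName (X i) (ℓ i) F ∘ chainMap X π i

/-- The integral of the penalty of the names at level `i`. -/
noncomputable def levelPenalty (ν : Measure (X 0).carrier) (i : ℕ) : ℝ :=
  ∑ s, ν.real (chainName X π F ℓ i ⁻¹' {s}) * penalty (M i) s

/-- The weighted entropy along `F` of the first `i + 1` levels, with penalties and potential. -/
noncomputable def weightedEnt (ν : Measure (X 0).carrier) : ℕ → ℝ
  | 0 => finEnt ν (chainName X π F ℓ 0) + levelPenalty X π F ℓ M ν 0 + ∫ x, birk (X 0) f F x ∂ν
  | i + 1 => (1 - a i) * finEnt ν (chainName X π F ℓ (i + 1)) +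
      levelPenalty X π F ℓ M ν (i + 1) + a i * weightedEnt ν i

theorem levelPenalty_eq_sum_restrict (ν : Measure (X 0).carrier) [IsFiniteMeasure ν]
    {κ : Type*} [Fintype κ] [MeasurableSpace κ] [MeasurableSingletonClass κ]
    {k : (X 0).carrier → κ} (hk : Measurable k) (i : ℕ) :
    levelPenalty X π F ℓ M ν i = ∑ t, levelPenalty X π F ℓ M (ν.restrict (k ⁻¹' {t})) i := by
  unfold levelPenalty
  rw [Finset.sum_comm]
  refine Finset.sum_congr rfl fun s _ => ?_
  rw [← Finset.sum_mul, sum_measureReal_restrict_fiber ν hk]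

theorem integral_eq_sum_restrict {Y : Type*} [MeasurableSpace Y] (ν : Measure Y) {κ : Type*}
    [Fintype κ] [MeasurableSpace κ] [MeasurableSingletonClass κ] {k : Y → κ} (hk : Measurable k)
    {h : Y → ℝ} (hh : Integrable h ν) :
    ∫ y, h y ∂ν = ∑ t, ∫ y in k ⁻¹' {t}, h y ∂ν := by
  rw [← integral_iUnion_fintype (fun t => hk (measurableSet_singleton t))
    (fun t t' htt => Set.disjoint_left.2 fun y hy hy' => htt (hy.symm.trans hy'))
    fun t => hh.integrableOn]
  have : ⋃ t, k ⁻¹' {t} = Set.univ := Set.eq_univ_of_forall fun y => by simp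
  rw [this, setIntegral_univ]

theorem weightedEnt_zero_measure (i : ℕ) : weightedEnt X π a f F ℓ M 0 i = 0 := by
  induction i with
  | zero => simp [weightedEnt, levelPenalty, finEnt]
  | succ i ih => simp [weightedEnt, levelPenalty, finEnt, ih]

theorem weightedEnt_le_sum_restrict {f : (X 0).carrier → ℝ} (hf : Continuous f)
    (ν : Measure (X 0).carrier) [IsFiniteMeasure ν]
    {κ : Type*} [Fintype κ] [MeasurableSpace κ] [MeasurableSingletonClass κ]
    {k : (X 0).carrier → κ} (hk : Measurable k) (i : ℕ)
    (ha : ∀ j < i, a j ∈ Set.Icc (0 : ℝ) 1) :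
    weightedEnt X π a f F ℓ M ν i ≤
      ∑ t, weightedEnt X π a f F ℓ M (ν.restrict (k ⁻¹' {t})) i := by
  induction i with
  | zero =>
    simp only [weightedEnt, Finset.sum_add_distrib]
    rw [← levelPenalty_eq_sum_restrict X π F ℓ M ν hk,
      integral_eq_sum_restrict ν hk (integrable_of_continuous ν (continuous_birk _ hf F))]
    have := finEnt_le_sum_restrict ν (chainName X π F ℓ 0) hk
    linarith
  | succ i ih =>
    simp only [weightedEnt, Finset.sum_add_distrib, ← Finset.mul_sum]
    rw [← levelPenalty_eq_sum_restrict X π F ℓ M ν hk]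
    have hai := ha i (Nat.lt_succ_self i)
    have h1 := mul_le_mul_of_nonneg_left
      (finEnt_le_sum_restrict ν (chainName X π F ℓ (i + 1)) hk) (sub_nonneg.2 hai.2)
    have h2 := mul_le_mul_of_nonneg_left (ih fun j hj => ha j (Nat.lt_succ_of_lt hj)) hai.1
    linarith

theorem wP_nonneg {G : Type} [Group G] (X : ℕ → GSystem G)
    (π : ∀ i, FactorMap (X i) (X (i + 1))) (a : ℕ → ℝ) (f : (X 0).carrier → ℝ) (F : Finset G)
    (ε : ℝ) (i : ℕ) (Ω : Set (X i).carrier) : 0 ≤ wP X π a f F ε i Ω := by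
  cases i with
  | zero =>
    refine Real.sInf_nonneg ?_
    rintro _ ⟨n, U, _, _, _, rfl⟩
    exact Finset.sum_nonneg fun j _ => (exp_pos _).le
  | succ i =>
    refine Real.sInf_nonneg ?_
    rintro _ ⟨n, U, _, _, _, rfl⟩
    exact Finset.sum_nonneg fun j _ => rpow_nonneg (wP_nonneg X π a f F ε i _) _

/-- The weighted entropy of a measure carried by `Ω` is controlled by the weighted cover sums of
`Ω`, up to a factor that is exponentially small in the cardinality of `F`. -/
theorem exp_weightedEnt_le {f : (X 0).carrier → ℝ} (hf : Continuous f)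
    (hℓm : ∀ i, Measurable (ℓ i)) {ε : ℝ} (hε : 0 < ε) {B : ℝ} (hB : 1 ≤ B) (i : ℕ)
    (ha : ∀ j < i, a j ∈ Set.Icc (0 : ℝ) 1)
    (hℓ : ∀ j ≤ i, ∀ x y, dist x y < ε → (ℓ j x).2 = false → (ℓ j y).2 = false → ℓ j x = ℓ j y)
    (hNB : ∀ j ≤ i, (1 + N j * exp (-M j)) ^ F.card ≤ B) (Ω : Set (X i).carrier)
    (ν : Measure (X 0).carrier) (hfin : IsFiniteMeasure ν) (hν : 0 < ν.real Set.univ)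
    (hνΩ : ν (chainMap X π i ⁻¹' Ωᶜ) = 0) :
    exp ((weightedEnt X π a f F ℓ M ν i - negMulLog (ν.real Set.univ)) / ν.real Set.univ) ≤
      B ^ (i + 1) * wP X π a f F ε i Ω := by
  have hB0 : 0 < B := one_pos.trans_le hB
  induction i generalizing ν with
  | zero =>
    have hint : ∀ ν' : Measure (X 0).carrier, IsFiniteMeasure ν' → Integrable (birk (X 0) f F) ν' :=
      fun ν' _ => integrable_of_continuous ν' (continuous_birk _ hf F)
    have h := exp_finEnt_add_le_sInf_cover (X 0) hε
      (W := fun U => exp (sSup (birk (X 0) f F '' U))) (Ω := Ω)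
      (continuous_chainMap X π 0).measurable ν hν hνΩ (hℓm 0) (hℓ 0 le_rfl) hB0 one_pos
      (hNB 0 le_rfl) (a := 0) (by simp) (C := fun U => exp (sSup (birk (X 0) f F '' U)))
      (fun U => (exp_pos _).le) (fun U => (one_mul _).ge)
      (R := fun ν' => ∫ x, birk (X 0) f F x ∂ν') (by simp)
      (fun n k hk => (integral_eq_sum_restrict ν hk (hint ν hfin)).le) ?_
    · simpa [weightedEnt, levelPenalty, chainName, wP] using h
    · intro U _ ν' hν' _ hU
      refine ⟨exp_pos _, ?_⟩
      rw [log_exp, zero_mul, zero_add, ← smul_eq_mul, ← integral_const]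
      refine integral_mono_ae (hint ν' hν') (integrable_const _) ?_
      have hae : ∀ᵐ x ∂ν', x ∈ U := by
        rw [ae_iff]
        exact hU
      filter_upwards [hae] with x hx
      refine le_csSup ?_ ⟨x, hx, rfl⟩
      exact (isCompact_range (continuous_birk _ hf F)).bddAbove.mono (Set.image_subset_range _ _)
  | succ i ih =>
    have hai := ha i (Nat.lt_succ_self i)
    have ha' : ∀ j < i, a j ∈ Set.Icc (0 : ℝ) 1 := fun j hj => ha j (Nat.lt_succ_of_lt hj)
    have ih := ih ha' (fun j hj => hℓ j (Nat.le_succ_of_le hj))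
      (fun j hj => hNB j (Nat.le_succ_of_le hj))
    have hD : 1 ≤ B ^ (i + 1) := one_le_pow₀ hB
    have hD0 : 0 < B ^ (i + 1) := one_pos.trans_le hD
    have hP : ∀ U, 0 ≤ wP X π a f F ε i U := fun U => wP_nonneg X π a f F ε i U
    have h := exp_finEnt_add_le_sInf_cover (X (i + 1)) hε
      (W := fun U => wP X π a f F ε i ((π i).toFun ⁻¹' U) ^ a i) (Ω := Ω)
      (continuous_chainMap X π (i + 1)).measurable ν hν hνΩ (hℓm (i + 1)) (hℓ (i + 1) le_rfl)
      hB0 hD0 (hNB (i + 1) le_rfl) hai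
      (C := fun U => (B ^ (i + 1) * wP X π a f F ε i ((π i).toFun ⁻¹' U)) ^ a i)
      (fun U => rpow_nonneg (mul_nonneg hD0.le (hP _)) _) (fun U => ?_)
      (R := fun ν' => a i * weightedEnt X π a f F ℓ M ν' i)
      (by simp [weightedEnt_zero_measure]) (fun n k hk => ?_) ?_
    · rw [← pow_succ'] at h
      simpa only [weightedEnt, levelPenalty, chainName, wP] using h
    · rw [mul_rpow hD0.le (hP _)]
      refine mul_le_mul_of_nonneg_right ?_ (rpow_nonneg (hP _) _)
      exact (rpow_le_rpow_of_exponent_le hD hai.2).trans_eq (rpow_one _)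
    · rw [← Finset.mul_sum]
      exact mul_le_mul_of_nonneg_left (weightedEnt_le_sum_restrict X π a F ℓ M hf ν hk i ha') hai.1
    · intro U _ ν' hν' hpos hU
      have hi := ih ((π i).toFun ⁻¹' U) ν' hν' hpos hU
      have hpos' := (exp_pos _).trans_le hi
      refine ⟨rpow_pos_of_pos hpos' _, ?_⟩
      rw [← le_log_iff_exp_le hpos', div_le_iff₀ hpos] at hi
      rw [log_rpow hpos']
      nlinarith [mul_le_mul_of_nonneg_left hi hai.1]

end WeightedEntropy

section LowerBound

/-- Every finite measurable partition can be modified on a set of small measure, recorded by the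
Boolean mark, so that nearby unmarked points get the same name. -/
theorem exists_marked_partition {Y : Type*} [MetricSpace Y] [CompactSpace Y] [MeasurableSpace Y]
    [BorelSpace Y] (μ : Measure Y) [IsFiniteMeasure μ] {N : ℕ} {q : Y → Fin N} (hq : Measurable q)
    {η : ℝ} (hη : 0 < η) :
    ∃ (ℓ : Y → Fin N × Bool) (M δ : ℝ), Measurable ℓ ∧ (∀ x, (ℓ x).1 = q x) ∧ 0 < δ ∧
      1 + N * exp (-M) ≤ exp η ∧ M * μ.real {x | (ℓ x).2 = true} ≤ η ∧
      ∀ x y, dist x y < δ → (ℓ x).2 = false → (ℓ y).2 = false → ℓ x = ℓ y := by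
  classical
  set M : ℝ := N / η with hM
  have hM0 : 0 ≤ M := by positivity
  have hc : 0 < η / (N * M + 1) := by positivity
  have hfib : ∀ j, MeasurableSet (q ⁻¹' {j}) := fun j => hq (measurableSet_singleton j)
  choose C hCq hC hCμ using fun j => (hfib j).exists_isCompact_sdiff_lt (measure_ne_top μ _)
    (ENNReal.ofReal_pos.2 hc).ne'
  have hCm : MeasurableSet (⋃ j, C j) := MeasurableSet.iUnion fun j => (hC j).measurableSet
  have hCuniq : ∀ {x j}, x ∈ C j → q x = j := fun {x j} hx => hCq j hx
  obtain ⟨δ, hδ, hball⟩ := lebesgue_number_lemma_of_metric (isCompact_iUnion hC)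
    (c := fun j => (⋃ k ∈ Finset.univ.erase j, C k)ᶜ)
    (fun j => (isClosed_biUnion_finset fun k _ => (hC k).isClosed).isOpen_compl)
    (fun x hx => by
      obtain ⟨j, hj⟩ := Set.mem_iUnion.1 hx
      refine Set.mem_iUnion.2 ⟨j, fun hx' => ?_⟩
      obtain ⟨k, hk, hxk⟩ := Set.mem_iUnion₂.1 hx'
      exact (Finset.mem_erase.1 hk).1 ((hCuniq hxk).symm.trans (hCuniq hj)))
  have hmark : ∀ x, decide (x ∉ ⋃ j, C j) = false → x ∈ C (q x) := by
    intro x hx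
    obtain ⟨j, hj⟩ := Set.mem_iUnion.1 (not_not.1 (of_decide_eq_false hx))
    rwa [hCuniq hj]
  refine ⟨fun x => (q x, decide (x ∉ ⋃ j, C j)), M, δ, hq.prodMk ?_, fun x => rfl, hδ, ?_, ?_, ?_⟩
  · exact measurable_to_bool (by simpa [Set.preimage, Set.compl_def] using hCm.compl)
  · have h1 : M ≤ exp M := by linarith [Real.add_one_le_exp M]
    have h2 : (N : ℝ) * exp (-M) ≤ η := by
      have : (N : ℝ) = η * M := by rw [hM]; field_simp
      rw [this, Real.exp_neg, ← div_eq_mul_inv, div_le_iff₀ (exp_pos M)]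
      exact mul_le_mul_of_nonneg_left h1 hη.le
    linarith [Real.add_one_le_exp η]
  · have hsub : {x | decide (x ∉ ⋃ j, C j) = true} ⊆ ⋃ j, q ⁻¹' {j} \ C j := fun x hx =>
      Set.mem_iUnion.2 ⟨q x, rfl, fun h => of_decide_eq_true hx (Set.mem_iUnion.2 ⟨q x, h⟩)⟩
    have hle : μ.real {x | decide (x ∉ ⋃ j, C j) = true} ≤ N * (η / (N * M + 1)) := by
      refine ((measureReal_mono hsub).trans (measureReal_iUnion_fintype_le _)).trans ?_
      refine (Finset.sum_le_card_nsmul _ _ (η / (N * M + 1)) fun j _ => ?_).trans_eq (by simp)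
      exact ENNReal.toReal_le_of_le_ofReal hc.le (hCμ j).le
    refine (mul_le_mul_of_nonneg_left hle hM0).trans ?_
    rw [← mul_assoc, mul_div_assoc', div_le_iff₀ (by positivity)]
    nlinarith
  · intro x y hxy hx hy
    have hxC := hmark x hx
    have hyC := hmark y hy
    obtain ⟨j, hj⟩ := hball x (Set.mem_iUnion.2 ⟨_, hxC⟩)
    have key : ∀ z ∈ Metric.ball x δ, z ∈ C (q z) → q z = j := fun z hz hzC => by
      by_contra hne
      exact hj hz (Set.mem_iUnion₂.2 ⟨q z, Finset.mem_erase.2 ⟨hne, Finset.mem_univ _⟩, hzC⟩)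
    refine Prod.ext ?_ (hx.trans hy.symm)
    exact (key x (Metric.mem_ball_self hδ) hxC).trans
      (key y (by rwa [Metric.mem_ball, dist_comm]) hyC).symm

section Invariant

variable {G : Type} [Group G]

theorem isInvProb_map_chainMap (X : ℕ → GSystem G) (π : ∀ i, FactorMap (X i) (X (i + 1)))
    {μ : Measure (X 0).carrier} (hμ : IsInvProb (X 0) μ) (i : ℕ) :
    IsInvProb (X i) (μ.map (chainMap X π i)) := by
  have := hμ.1
  have hm := (continuous_chainMap X π i).measurable
  refine ⟨Measure.isProbabilityMeasure_map hm.aemeasurable, fun g => ?_⟩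
  have : (X i).act g ∘ chainMap X π i = chainMap X π i ∘ (X 0).act g :=
    funext fun x => (chainMap_act X π g i x).symm
  rw [Measure.map_map (measurable_act _ g) hm, this,
    ← Measure.map_map hm (measurable_act _ g), hμ.2 g]

theorem integral_comp_act (S : GSystem G) {μ : Measure S.carrier} (hμ : IsInvProb S μ)
    {h : S.carrier → ℝ} (hh : Measurable h) (g : G) :
    ∫ x, h (S.act g x) ∂μ = ∫ x, h x ∂μ := by
  conv_rhs => rw [← hμ.2 g]
  rw [integral_map (measurable_act S g).aemeasurable hh.aestronglyMeasurable]

theorem integral_birk (S : GSystem G) {μ : Measure S.carrier} (hμ : IsInvProb S μ)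
    {f : S.carrier → ℝ} (hf : Measurable f) (hfi : Integrable f μ) (F : Finset G) :
    ∫ x, birk S f F x ∂μ = F.card * ∫ x, f x ∂μ := by
  have hi : ∀ g, Integrable (fun x => f (S.act g x)) μ := fun g => by
    refine Integrable.comp_measurable (f := S.act g) ?_ (measurable_act S g)
    rwa [hμ.2 g]
  simp only [birk]
  rw [integral_finsetSum _ fun g _ => hi g, Finset.sum_congr rfl fun g _ =>
    integral_comp_act S hμ hf g, Finset.sum_const, nsmul_eq_mul]

variable [DecidableEq G]

theorem finEnt_orbitName_le_of_factor (S : GSystem G) (μ : Measure S.carrier) [IsFiniteMeasure μ]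
    {κ κ' : Type*} [Fintype κ] [Fintype κ'] [MeasurableSpace κ] [MeasurableSingletonClass κ]
    {p : S.carrier → κ} (hp : Measurable p) (φ : κ → κ') (F : Finset G) :
    finEnt μ (orbitName S (φ ∘ p) F) ≤ finEnt μ (orbitName S p F) := by
  rw [← finEnt_comp_injective μ (orbitName S p F) (e := fun s => (φ ∘ s, s))
    fun s t hst => (Prod.mk.inj hst).2]
  exact finEnt_le_finEnt_pair μ (orbitName S (φ ∘ p) F) (measurable_orbitName S hp F)

theorem levelPenalty_eq (X : ℕ → GSystem G) (π : ∀ i, FactorMap (X i) (X (i + 1))) (F : Finset G)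
    {N : ℕ → ℕ} {ℓ : ∀ i, (X i).carrier → Fin (N i) × Bool} (hℓ : ∀ i, Measurable (ℓ i))
    (M : ℕ → ℝ) {μ : Measure (X 0).carrier} (hμ : IsInvProb (X 0) μ) (i : ℕ) :
    levelPenalty X π F ℓ M μ i =
      -(F.card * (M i * (μ.map (chainMap X π i)).real {z | (ℓ i z).2 = true})) := by
  have := hμ.1
  have hinv := isInvProb_map_chainMap X π hμ i
  have := hinv.1
  have hname := measurable_orbitName (X i) (hℓ i) F
  have hD : MeasurableSet {z | (ℓ i z).2 = true} :=
    (measurable_snd.comp (hℓ i)) (measurableSet_singleton true)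
  have hbirk : ∀ z, penalty (M i) (orbitName (X i) (ℓ i) F z) =
      birk (X i) ({z | (ℓ i z).2 = true}.indicator fun _ => -M i) F z := fun z => by
    simp only [penalty, orbitName, birk, Set.indicator_apply, Set.mem_ofPred_eq]
    exact Finset.sum_coe_sort F fun g => if (ℓ i ((X i).act g z)).2 = true then -M i else 0
  have hsum : levelPenalty X π F ℓ M μ i =
      ∫ z, penalty (M i) (orbitName (X i) (ℓ i) F z) ∂μ.map (chainMap X π i) := by
    rw [← integral_map hname.aemeasurable (measurable_of_finite _).aestronglyMeasurable,
      integral_fintype .of_finite]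
    refine Finset.sum_congr rfl fun s _ => ?_
    rw [smul_eq_mul, map_measureReal_apply hname (measurableSet_singleton s),
      map_measureReal_apply (continuous_chainMap X π i).measurable
        (hname (measurableSet_singleton s))]
    rfl
  rw [hsum, integral_congr_ae (.of_forall hbirk), integral_birk (X i) hinv
    (measurable_const.indicator hD) ((integrable_const _).indicator hD),
    integral_indicator_const _ hD, smul_eq_mul]
  ring

theorem wt_succ (a : ℕ → ℝ) {i j : ℕ} (hj : j ≤ i) :
    wt a (i + 2) j = a i * wt a (i + 1) j := by
  unfold wt
  split_ifs with h
  · rw [show i + 2 - 1 = i + 1 from rfl, Finset.prod_range_succ, mul_comm]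
    rfl
  · rw [show i + 2 - 1 = i + 1 from rfl, Finset.prod_Ico_succ_top hj,
      show i + 1 - 1 = i from rfl]
    ring

theorem wt_succ_self (a : ℕ → ℝ) (i : ℕ) : wt a (i + 2) (i + 1) = 1 - a i := by
  simp [wt]

theorem wt_nonneg {a : ℕ → ℝ} {r : ℕ} (ha : ∀ i < r - 1, a i ∈ Set.Icc (0 : ℝ) 1) {i : ℕ}
    (hi : i < r) : 0 ≤ wt a r i := by
  unfold wt
  split_ifs with h
  · exact Finset.prod_nonneg fun j hj => (ha j (Finset.mem_range.1 hj)).1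
  · exact mul_nonneg (sub_nonneg.2 (ha _ (by omega)).2)
      (Finset.prod_nonneg fun j hj => (ha j (Finset.mem_Ico.1 hj).2).1)

theorem card_mul_sum_wt_le_weightedEnt (X : ℕ → GSystem G)
    (π : ∀ i, FactorMap (X i) (X (i + 1))) (a : ℕ → ℝ) (f : (X 0).carrier → ℝ) (F : Finset G)
    {N : ℕ → ℕ} (ℓ : ∀ i, (X i).carrier → Fin (N i) × Bool) (M : ℕ → ℝ)
    (μ : Measure (X 0).carrier) {h : ℕ → ℝ} {c η : ℝ} (hη : 0 ≤ η)
    (hf : F.card * c ≤ ∫ x, birk (X 0) f F x ∂μ)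
    (hh : ∀ j, h j * F.card ≤ finEnt μ (chainName X π F ℓ j))
    (hpen : ∀ j, -(F.card * η) ≤ levelPenalty X π F ℓ M μ j) (i : ℕ)
    (ha : ∀ j < i, a j ∈ Set.Icc (0 : ℝ) 1) :
    F.card * (∑ j ∈ Finset.range (i + 1), wt a (i + 1) j * h j + wt a (i + 1) 0 * c
      - (i + 1) * η) ≤ weightedEnt X π a f F ℓ M μ i := by
  induction i with
  | zero =>
    simp only [weightedEnt, zero_add, Finset.sum_range_one, wt, if_true, Nat.sub_self,
      Finset.range_zero, Finset.prod_empty, Nat.cast_zero, one_mul]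
    linarith [hh 0, hpen 0]
  | succ i ih =>
    have hai := ha i (Nat.lt_succ_self i)
    have ih := mul_le_mul_of_nonneg_left (ih fun j hj => ha j (Nat.lt_succ_of_lt hj)) hai.1
    have h1 := mul_le_mul_of_nonneg_left (hh (i + 1)) (sub_nonneg.2 hai.2)
    have h2 := hpen (i + 1)
    have h3 : a i * ((i + 1) * (F.card * η)) ≤ (i + 1) * (F.card * η) :=
      mul_le_of_le_one_left (by positivity) hai.2
    rw [Finset.sum_range_succ, wt_succ_self, wt_succ a (Nat.zero_le i),
      Finset.sum_congr rfl fun j hj => by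
        rw [wt_succ a (Nat.lt_succ_iff.1 (Finset.mem_range.1 hj)), mul_assoc], ← Finset.mul_sum]
    simp only [weightedEnt]
    push_cast
    linarith

/-- The variational inequality for a fixed invariant measure and fixed partitions. -/
theorem sum_hSeq_add_integral_le_press {Fn : ℕ → Finset G} (hFn : IsFolner G Fn)
    (X : ℕ → GSystem G) (π : ∀ i, FactorMap (X i) (X (i + 1))) {r : ℕ} (hr : 1 ≤ r) {a : ℕ → ℝ}
    (ha : ∀ i < r - 1, a i ∈ Set.Icc (0 : ℝ) 1) {f : (X 0).carrier → ℝ} (hf : Continuous f)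
    {μ : Measure (X 0).carrier} (hμ : IsInvProb (X 0) μ)
    (p : ∀ i, {p : (X i).carrier → ℕ // Measurable p ∧ (Set.range p).Finite}) :
    ((∑ i ∈ Finset.range r, wt a r i * hSeq (X i) Fn (μ.map (chainMap X π i)) (p i).1 +
      wt a r 0 * ∫ x, f x ∂μ : ℝ) : EReal) ≤ press X π r a f Fn := by
  have hprob := hμ.1
  have hinv := isInvProb_map_chainMap X π hμ
  have hprobi := fun i => (hinv i).1
  obtain ⟨i, rfl⟩ : ∃ i, r = i + 1 := ⟨r - 1, by omega⟩
  rw [← EReal.ge_of_forall_gt_iff_ge]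
  intro z hz
  rw [EReal.coe_lt_coe_iff] at hz
  set A := ∑ j ∈ Finset.range (i + 1),
    wt a (i + 1) j * hSeq (X j) Fn (μ.map (chainMap X π j)) (p j).1 +
      wt a (i + 1) 0 * ∫ x, f x ∂μ with hA
  obtain ⟨η, hη, hzη⟩ : ∃ η > 0, z ≤ A - (i + 1) * η - (i + 1) * η :=
    ⟨(A - z) / (2 * (i + 1)), div_pos (sub_pos.2 hz) (by positivity),
      le_of_eq (by field_simp; ring)⟩
  have hbdd : ∀ j, ∃ N : ℕ, ∀ x, (p j).1 x < N := fun j => by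
    obtain ⟨N, hN⟩ := (p j).2.2.bddAbove
    exact ⟨N + 1, fun x => Nat.lt_succ_of_le (hN ⟨x, rfl⟩)⟩
  choose N hN using hbdd
  have hq : ∀ j, Measurable fun x => (⟨(p j).1 x, hN j x⟩ : Fin (N j)) := fun j =>
    measurable_to_countable' fun k => by
      convert (p j).2.1 (measurableSet_singleton (k : ℕ)) using 1
      ext x
      simp [Fin.ext_iff]
  choose ℓ M δ hℓm hℓq hδ hNM hMD hsep using fun j =>
    exists_marked_partition (μ.map (chainMap X π j)) (hq j) hη
  obtain ⟨m, -, hm⟩ := Finset.exists_min_image (Finset.range (i + 1)) δ ⟨0, by simp⟩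
  refine le_iSup₂_of_le (δ m) (hδ m) (Filter.le_limsup_of_frequently_le'
    (Filter.Frequently.of_forall fun n => ?_))
  rw [EReal.coe_le_coe_iff]
  have hcard : (0 : ℝ) < (Fn n).card := by exact_mod_cast (hFn.1 n).card_pos
  rw [Nat.add_sub_cancel, le_div_iff₀ hcard]
  have hupper := exp_weightedEnt_le X π a (Fn n) ℓ M hf hℓm (hδ m)
    (B := exp (η * (Fn n).card)) (Real.one_le_exp (by positivity)) i ha
    (fun j hj x y hxy => hsep j x y (hxy.trans_le (hm j (by simpa using Nat.lt_succ_of_le hj))))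
    (fun j _ => by
      rw [mul_comm η, Real.exp_nat_mul]
      exact pow_le_pow_left₀ (by positivity) (hNM j) _)
    Set.univ μ inferInstance (by simp) (by simp)
  have hwP : 0 < wP X π a f (Fn n) (δ m) i Set.univ :=
    pos_of_mul_pos_right ((exp_pos _).trans_le hupper) (by positivity)
  rw [← le_log_iff_exp_le (by positivity), log_mul (by positivity) hwP.ne', log_pow, log_exp,
    probReal_univ, Real.negMulLog_one, sub_zero, div_one] at hupper
  have hlower := card_mul_sum_wt_le_weightedEnt X π a f (Fn n) ℓ M μ hη.le
    (integral_birk (X 0) hμ hf.measurable (integrable_of_continuous μ hf) (Fn n)).ge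
    (h := fun j => hSeq (X j) Fn (μ.map (chainMap X π j)) (p j).1) (fun j => ?_) (fun j => ?_)
    i ha
  · push_cast at hupper
    rw [← hA] at hlower
    have := mul_le_mul_of_nonneg_right hzη hcard.le
    linarith
  · refine (hSeq_mul_card_le hFn (X j) (hinv j) (hq j) (fun x => rfl) (hFn.1 n)).trans ?_
    have hfac : (fun x => (⟨(p j).1 x, hN j x⟩ : Fin (N j))) = Prod.fst ∘ ℓ j :=
      funext fun x => (hℓq j x).symm
    rw [hfac]
    refine (finEnt_orbitName_le_of_factor (X j) _ (hℓm j) Prod.fst (Fn n)).trans_eq ?_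
    exact finEnt_map μ (continuous_chainMap X π j).measurable (measurable_orbitName _ (hℓm j) _)
  · rw [levelPenalty_eq X π (Fn n) hℓm M hμ j]
    exact neg_le_neg (mul_le_mul_of_nonneg_left (hMD j) hcard.le)

end Invariant

theorem exists_lt_mul_of_lt_mul_iSup {ι : Type*} [Nonempty ι] {w : ℝ} (hw : 0 ≤ w) {h : ι → ℝ}
    {b : EReal} (hb : b < (w : EReal) * ⨆ p, (h p : EReal)) : ∃ p, b < ((w * h p : ℝ) : EReal) := by
  rcases hw.eq_or_lt with rfl | hw
  · exact ⟨Classical.arbitrary ι, by simpa using hb⟩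
  · by_contra! hle
    refine hb.not_ge ?_
    rw [mul_comm, ← EReal.le_div_iff_mul_le (EReal.coe_pos.2 hw) (EReal.coe_ne_top w)]
    refine iSup_le fun p => ?_
    rw [EReal.le_div_iff_mul_le (EReal.coe_pos.2 hw) (EReal.coe_ne_top w), mul_comm]
    exact_mod_cast hle p

theorem sum_mul_iSup_add_le {κ : Type*} [DecidableEq κ] {ι : κ → Type*} [∀ i, Nonempty (ι i)]
    (J : Finset κ) {w : κ → ℝ} (hw : ∀ i ∈ J, 0 ≤ w i) {h : ∀ i, ι i → ℝ} {c : ℝ} {B : EReal}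
    (hB : ∀ p : ∀ i, ι i, ((∑ i ∈ J, w i * h i (p i) + c : ℝ) : EReal) ≤ B) :
    ∑ i ∈ J, (w i : EReal) * (⨆ p, (h i p : EReal)) + (c : EReal) ≤ B := by
  induction J using Finset.induction_on generalizing c with
  | empty => simpa using hB fun i => Classical.arbitrary (ι i)
  | insert j J hj ih =>
    rw [Finset.sum_insert hj, add_assoc]
    refine EReal.add_le_of_forall_lt fun b hb b' hb' => ?_
    obtain ⟨q, hq⟩ := exists_lt_mul_of_lt_mul_iSup (hw j (Finset.mem_insert_self j J)) hb
    refine (add_le_add hq.le hb'.le).trans ?_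
    rw [add_left_comm, ← EReal.coe_add]
    refine ih (fun i hi => hw i (Finset.mem_insert_of_mem hi)) fun p => ?_
    have := hB (Function.update p j q)
    rw [Finset.sum_insert hj, Function.update_self, Finset.sum_congr rfl fun i hi => by
      rw [Function.update_of_ne (ne_of_mem_of_not_mem hi hj)]] at this
    rwa [← add_assoc, add_comm _ (w j * _)]

end LowerBound

end WPP

open WPP in
/-- **Lower bound half of the variational principle** (Theorem 3.1): for every `f ∈ C(X_1)`,
`sup_{μ ∈ M^G(X_1)} ( Σ_{i=1}^r w_i h_{μ_i}(X_i,G) + w_1 ∫_{X_1} f dμ ) ≤ P^a(f,G)`. -/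
theorem weighted_pressure_lower_bound
    {G : Type} [Group G] [Countable G] [Infinite G]
    (Fn : ℕ → Finset G) (hFn : IsFolner G Fn)
    (X : ℕ → GSystem G) (π : ∀ i, FactorMap (X i) (X (i + 1)))
    (r : ℕ) (hr : 2 ≤ r) (a : ℕ → ℝ) (ha : ∀ i < r - 1, a i ∈ Set.Icc (0 : ℝ) 1)
    (f : (X 0).carrier → ℝ) (hf : Continuous f) :
    Pvar X π r a Fn f ≤ press X π r a f Fn := by
  classical
  refine iSup_le fun μ => ?_
  have : ∀ i, Nonempty {p : (X i).carrier → ℕ // Measurable p ∧ (Set.range p).Finite} := fun i =>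
    ⟨⟨fun _ => 0, measurable_const, (Set.finite_singleton 0).subset (by rintro _ ⟨_, rfl⟩; rfl)⟩⟩
  exact sum_mul_iSup_add_le (Finset.range r) (fun i hi => wt_nonneg ha (Finset.mem_range.1 hi))
    fun p => sum_hSeq_add_integral_le_press hFn X π (by omega) ha hf μ.2 p
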